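/- arXiv:2302.14773 — 2 statements merged into one kernel-verified Lean document; each statement's English description precedes it below -/
import Mathlib

section
/- A C*-algebra A is commutative if and only if for all a, x ∈ A the element (1/2)(a a* x + x a* a) belongs to the norm closure of the set { a y a : y ∈ A }. -/
section ReducedCStarAlgebra

variable {A : Type*} [NonUnitalCStarAlgebra A]

/-- In a commutative C*-algebra, `a* a x` lies in the norm closure of `a A a`. -/
theorem star_mul_self_mul_mem_closure (hc : ∀ x y : A, x * y = y * x) (a x : A) :
    star a * a * x ∈ closure {z : A | ∃ y : A, z = a * y * a} := by
  set h := star a * a with hh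
  have hsa : IsSelfAdjoint h := IsSelfAdjoint.star_mul_self a
  rw [Metric.mem_closure_iff]
  intro ε hε
  obtain ⟨η, hη, hηε⟩ : ∃ η : ℝ, 0 < η ∧ η * ‖x‖ < ε := by
    refine ⟨ε / (‖x‖ + 1), by positivity, ?_⟩
    rw [div_mul_eq_mul_div, div_lt_iff₀ (by positivity)]
    nlinarith [norm_nonneg x]
  have hpos : ∀ t : ℝ, t ^ 2 + η ^ 2 ≠ 0 := fun t => by positivity
  have hcont : Continuous fun t : ℝ => t / (t ^ 2 + η ^ 2) :=
    continuous_id.div (by fun_prop) hpos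
  set g : A := cfcₙ (fun t : ℝ => t / (t ^ 2 + η ^ 2)) h with hg
  refine ⟨a * (star a * star a * g * x) * a, ⟨_, rfl⟩, ?_⟩
  have hprod : a * (star a * star a * g * x) * a = h * h * g * x := by
    let _ : NonUnitalCommRing A := { (inferInstance : NonUnitalRing A) with mul_comm := hc }
    have e : ∀ b : A, a * (b * b * g * x) * a = b * a * (b * a) * g * x := fun b => by
      rw [hc _ a]
      simp only [← mul_assoc]
      rw [hc (b * a) b, hc (a * a) b]
      simp only [← mul_assoc]
      rw [mul_assoc b a a, hc b (a * a), mul_assoc (a * a) b b, hc (a * a), mul_assoc b b]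
      simp only [← mul_assoc]
    exact e _
  have hdiff : h - h * h * g = cfcₙ (fun t : ℝ => t - t * t * (t / (t ^ 2 + η ^ 2))) h := by
    rw [cfcₙ_sub (fun t : ℝ => t) (fun t : ℝ => t * t * (t / (t ^ 2 + η ^ 2))) h
        (by fun_prop) (by simp) (Continuous.mul (by fun_prop) hcont).continuousOn (by simp),
      cfcₙ_mul (fun t : ℝ => t * t) (fun t : ℝ => t / (t ^ 2 + η ^ 2)) h
        (by fun_prop) (by simp) hcont.continuousOn (by simp),
      cfcₙ_mul (fun t : ℝ => t) (fun t : ℝ => t) h, cfcₙ_id' ℝ h]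
  have hnorm : ‖h - h * h * g‖ ≤ η := by
    rw [hdiff]
    refine norm_cfcₙ_le fun t _ => ?_
    have e : t - t * t * (t / (t ^ 2 + η ^ 2)) = t * η ^ 2 / (t ^ 2 + η ^ 2) := by
      field_simp [hpos t]
      ring
    rw [e, Real.norm_eq_abs, abs_div, abs_of_pos (show 0 < t ^ 2 + η ^ 2 by positivity),
      div_le_iff₀ (by positivity), abs_mul, abs_of_nonneg (sq_nonneg η)]
    nlinarith [sq_nonneg (|t| - η), sq_abs t, abs_nonneg t, mul_nonneg hη.le (abs_nonneg t)]
  rw [hprod, dist_eq_norm, ← sub_mul]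
  exact (norm_mul_le _ _).trans_lt
    ((mul_le_mul_of_nonneg_right hnorm (norm_nonneg x)).trans_lt hηε)

/-- If `L(a,a)(A)` lies in the closed inner ideal generated by `a` and `a² = 0`, then `a = 0`. -/
theorem eq_zero_of_L_mem_inner_ideal_of_mul_self_eq_zero {a : A}
    (H : ∀ x : A, (1 / 2 : ℂ) • (a * star a * x + x * (star a * a)) ∈
        closure {z : A | ∃ y : A, z = a * y * a})
    (ha : a * a = 0) : a = 0 := by
  have hsub : closure {z : A | ∃ y : A, z = a * y * a} ⊆ {z | a * z = 0} := by
    refine closure_minimal ?_ (isClosed_eq (by fun_prop) continuous_const)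
    rintro _ ⟨y, rfl⟩
    simp [← mul_assoc, ha]
  have h1 : a * ((1 / 2 : ℂ) • (a * star a * (star a * a) + star a * a * (star a * a))) = 0 :=
    hsub (H (star a * a))
  rw [mul_smul_comm, smul_eq_zero_iff_right (by norm_num), mul_add, ← mul_assoc,
    ← mul_assoc a a, ha, zero_mul, zero_mul, zero_add] at h1
  have hs : star (star a * a) = star a * a := by simp
  have h2 : star (star a * a * (star a * a)) * (star a * a * (star a * a)) = 0 := by
    rw [star_mul, hs]
    calc star a * a * (star a * a) * (star a * a * (star a * a))
        = star a * a * star a * (a * (star a * a * (star a * a))) := by simp only [mul_assoc]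
      _ = 0 := by rw [h1, mul_zero]
  rw [CStarRing.star_mul_self_eq_zero_iff] at h2
  nth_rewrite 1 [← hs] at h2
  rwa [CStarRing.star_mul_self_eq_zero_iff, CStarRing.star_mul_self_eq_zero_iff] at h2

/-- In a reduced algebra, `q p = δ p` forces `p x (δ - q) = 0`. -/
theorem mul_mul_eq_smul_mul_of_reduced (hred : ∀ a : A, a * a = 0 → a = 0) {p q : A} {δ : ℝ}
    (hqp : q * p = δ • p) (x : A) : p * x * q = δ • (p * x) := by
  rw [← sub_eq_zero]
  apply hred
  have e1 : p * x * q * (p * x * q) = δ • (p * x * (p * x * q)) := by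
    rw [mul_assoc (p * x) q, ← mul_assoc q, ← mul_assoc q, hqp]
    simp only [smul_mul_assoc, mul_smul_comm]
  have e2 : p * x * q * (p * x) = δ • (p * x * (p * x)) := by
    rw [mul_assoc (p * x) q, ← mul_assoc q, hqp]
    simp only [smul_mul_assoc, mul_smul_comm]
  simp only [sub_mul, mul_sub, e1, e2, smul_mul_assoc, mul_smul_comm, smul_sub]
  abel

/-- In a reduced algebra, `p q = δ p` forces `(δ - q) x p = 0`. -/
theorem mul_mul_eq_smul_mul_of_reduced' (hred : ∀ a : A, a * a = 0 → a = 0) {p q : A} {δ : ℝ}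
    (hpq : p * q = δ • p) (x : A) : q * x * p = δ • (x * p) := by
  rw [← sub_eq_zero]
  apply hred
  have e1 : q * x * p * (q * x * p) = δ • (q * x * p * (x * p)) := by
    rw [mul_assoc (q * x) p, mul_assoc q x p, ← mul_assoc p, hpq]
    simp only [smul_mul_assoc, mul_smul_comm, mul_assoc]
  have e2 : x * p * (q * x * p) = δ • (x * p * (x * p)) := by
    rw [mul_assoc x p, ← mul_assoc p, ← mul_assoc p, hpq]
    simp only [smul_mul_assoc, mul_smul_comm, mul_assoc]
  simp only [sub_mul, mul_sub, e1, e2, smul_mul_assoc, mul_smul_comm, smul_sub]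
  abel

/-- In a reduced algebra, the squared inner derivation is additive on pairs `p`, `q` with
`p q = q p = δ p`. -/
theorem iterated_commutator_add_of_reduced (hred : ∀ a : A, a * a = 0 → a = 0) {p q : A} {δ : ℝ}
    (hpq : p * q = δ • p) (hqp : q * p = δ • p) (x : A) :
    (p + q) * ((p + q) * x - x * (p + q)) - ((p + q) * x - x * (p + q)) * (p + q) =
      (p * (p * x - x * p) - (p * x - x * p) * p) +
        (q * (q * x - x * q) - (q * x - x * q) * q) := by
  have h1 := mul_mul_eq_smul_mul_of_reduced hred hqp x
  have h2 := mul_mul_eq_smul_mul_of_reduced' hred hpq x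
  have h3 : p * (q * x) = δ • (p * x) := by rw [← mul_assoc, hpq, smul_mul_assoc]
  have h4 : q * (p * x) = δ • (p * x) := by rw [← mul_assoc, hqp, smul_mul_assoc]
  have h5 : x * p * q = δ • (x * p) := by rw [mul_assoc, hpq, mul_smul_comm]
  have h6 : x * q * p = δ • (x * p) := by rw [mul_assoc, hqp, mul_smul_comm]
  have h1' : p * (x * q) = δ • (p * x) := by rw [← mul_assoc, h1]
  have h2' : q * (x * p) = δ • (x * p) := by rw [← mul_assoc, h2]
  simp only [add_mul, mul_add, mul_sub, sub_mul, h1, h2, h3, h4, h5, h6, h1', h2']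
  abel

/-- In a reduced algebra, the squared inner derivation of `f(b)`, where `0 ≤ f ≤ δ` on the
spectrum of `b`, has arbitrarily small norm: cut `f` at height `δ / 2` and iterate. -/
theorem norm_iterated_commutator_cfcₙ_le (hred : ∀ a : A, a * a = 0 → a = 0) {b : A}
    (x : A) (n : ℕ) :
    ∀ (f : ℝ → ℝ) (δ : ℝ), Continuous f → f 0 = 0 → 0 ≤ δ →
      (∀ t ∈ quasispectrum ℝ b, 0 ≤ f t ∧ f t ≤ δ) →
      ‖cfcₙ f b * (cfcₙ f b * x - x * cfcₙ f b) - (cfcₙ f b * x - x * cfcₙ f b) * cfcₙ f b‖ ≤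
        4 * δ ^ 2 * ‖x‖ / 2 ^ n := by
  induction n with
  | zero =>
    intro f δ _ _ hδ hf
    have hn : ‖cfcₙ f b‖ ≤ δ := norm_cfcₙ_le fun t ht => by
      rw [Real.norm_eq_abs, abs_of_nonneg (hf t ht).1]
      exact (hf t ht).2
    have key : ∀ y : A, ‖cfcₙ f b * y - y * cfcₙ f b‖ ≤ 2 * δ * ‖y‖ := fun y => by
      have h1 := norm_sub_le (cfcₙ f b * y) (y * cfcₙ f b)
      have h2 := norm_mul_le (cfcₙ f b) y
      have h3 := norm_mul_le y (cfcₙ f b)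
      have h4 := mul_le_mul_of_nonneg_right hn (norm_nonneg y)
      linarith [mul_comm ‖y‖ ‖cfcₙ f b‖]
    have h5 := mul_le_mul_of_nonneg_left (key x) (show 0 ≤ 2 * δ by positivity)
    refine (key _).trans (h5.trans (le_of_eq ?_))
    ring
  | succ n ih =>
    intro f δ hfc hf0 hδ hf
    set p : A := cfcₙ (fun t => max (f t - δ / 2) 0) b with hp
    set q : A := cfcₙ (fun t => min (f t) (δ / 2)) b with hq
    have hp0 : max (f 0 - δ / 2) 0 = 0 := by rw [hf0]; exact max_eq_right (by linarith)
    have hq0 : min (f 0) (δ / 2) = 0 := by rw [hf0]; exact min_eq_left (by linarith)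
    have hsum : cfcₙ f b = p + q := by
      rw [hp, hq, ← cfcₙ_add (fun t => max (f t - δ / 2) 0) (fun t => min (f t) (δ / 2)) b
        (by fun_prop) hp0 (by fun_prop) hq0]
      congr 1
      funext t
      rcases le_total (f t) (δ / 2) with h | h
      · rw [max_eq_right (by linarith), min_eq_left h, zero_add]
      · rw [max_eq_left (by linarith), min_eq_right h, sub_add_cancel]
    have hpq : p * q = (δ / 2) • p := by
      rw [hp, hq, ← cfcₙ_mul (fun t => max (f t - δ / 2) 0) (fun t => min (f t) (δ / 2)) b
        (by fun_prop) hp0 (by fun_prop) hq0,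
        ← cfcₙ_smul (δ / 2) (fun t => max (f t - δ / 2) 0) b (by fun_prop) hp0]
      congr 1
      funext t
      rcases le_total (f t) (δ / 2) with h | h
      · rw [max_eq_right (by linarith), zero_mul, smul_zero]
      · rw [min_eq_right h, smul_eq_mul, mul_comm]
    have hqp : q * p = (δ / 2) • p := by
      rw [← hpq]
      exact (cfcₙ_commute_cfcₙ _ _ b).eq
    rw [hsum, iterated_commutator_add_of_reduced hred hpq hqp x]
    refine (norm_add_le _ _).trans ?_
    have h1 := ih (fun t => max (f t - δ / 2) 0) (δ / 2) (by fun_prop) hp0 (by linarith)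
      fun t ht => ⟨le_max_right _ _, max_le (by linarith [(hf t ht).2]) (by linarith)⟩
    have h2 := ih (fun t => min (f t) (δ / 2)) (δ / 2) (by fun_prop) hq0 (by linarith)
      fun t ht => ⟨le_min (hf t ht).1 (by linarith), min_le_right _ _⟩
    refine (add_le_add h1 h2).trans (le_of_eq ?_)
    rw [pow_succ]
    field_simp
    ring

/-- If the inner derivation of a self-adjoint `h` has square zero, then `h` is central. -/
theorem commute_of_iterated_commutator_eq_zero {h : A} (hh : IsSelfAdjoint h)
    (H : ∀ x : A, h * (h * x - x * h) - (h * x - x * h) * h = 0) (x : A) : h * x = x * h := by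
  have e : (2 : ℂ) • ((h * x - x * h) * (h * star x - star x * h)) = 0 := by
    have e' : (2 : ℂ) • ((h * x - x * h) * (h * star x - star x * h)) =
        (h * (h * (x * star x) - x * star x * h) - (h * (x * star x) - x * star x * h) * h) -
          (h * (h * x - x * h) - (h * x - x * h) * h) * star x -
          x * (h * (h * star x - star x * h) - (h * star x - star x * h) * h) := by
      rw [two_smul]
      simp only [mul_sub, sub_mul, mul_assoc]
      abel
    rw [e', H, H, H]
    simp
  rw [smul_eq_zero_iff_right two_ne_zero] at e
  have hstar : h * star x - star x * h = -star (h * x - x * h) := by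
    simp [hh.star_eq]
  rw [hstar, mul_neg, neg_eq_zero, CStarRing.mul_star_self_eq_zero_iff] at e
  exact sub_eq_zero.mp e

/-- A C*-algebra without nonzero elements of square zero is commutative. -/
theorem mul_comm_of_reduced (hred : ∀ a : A, a * a = 0 → a = 0) (x y : A) : x * y = y * x := by
  have hpos : ∀ b : A, IsSelfAdjoint b → ∀ z : A, b⁺ * z = z * b⁺ := fun b hb => by
    refine commute_of_iterated_commutator_eq_zero (by rw [CFC.posPart_def]; exact cfcₙ_predicate _ b) fun z => ?_
    obtain ⟨δ, hδ⟩ := (quasispectrum.isCompact (𝕜 := ℝ) b).bddAbove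
    have hbound : ∀ n : ℕ, ‖b⁺ * (b⁺ * z - z * b⁺) - (b⁺ * z - z * b⁺) * b⁺‖ ≤
        4 * (max δ 0) ^ 2 * ‖z‖ / 2 ^ n := fun n => by
      rw [CFC.posPart_def]
      exact norm_iterated_commutator_cfcₙ_le hred z n (fun t => t⁺) (max δ 0)
        (by simp only [posPart_def]; fun_prop) (by simp) (le_max_right _ _)
        fun t ht => ⟨posPart_nonneg t, max_le_max (hδ ht) le_rfl⟩
    have hlim : Filter.Tendsto (fun n : ℕ => 4 * (max δ 0) ^ 2 * ‖z‖ / 2 ^ n) Filter.atTop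
        (nhds 0) :=
      tendsto_const_nhds.div_atTop (tendsto_pow_atTop_atTop_of_one_lt one_lt_two)
    exact norm_le_zero_iff.mp (ge_of_tendsto' hlim hbound)
  have hsa : ∀ b : A, IsSelfAdjoint b → b * y = y * b := fun b hb => by
    have h2 := hpos (-b) hb.neg y
    rw [CFC.posPart_neg] at h2
    rw [← CFC.posPart_sub_negPart b hb, sub_mul, mul_sub, hpos b hb y, h2]
  rw [← realPart_add_I_smul_imaginaryPart x, add_mul, mul_add, smul_mul_assoc, mul_smul_comm,
    hsa _ (realPart x).2, hsa _ (imaginaryPart x).2]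

end ReducedCStarAlgebra

/-- A C*-algebra `A` is commutative if and only if for all `a, x ∈ A` the element
`(1/2)(a a* x + x a* a)` belongs to the norm closure of `{ a y a : y ∈ A }`.
(In JB*-triple terms: `L(a,a)(A) ⊆ A(a)` for all `a ∈ A`.) -/
theorem commutative_iff_L_mem_inner_ideal {A : Type*} [NonUnitalNormedRing A] [StarRing A]
    [CStarRing A] [NormedSpace ℂ A] [IsScalarTower ℂ A A] [SMulCommClass ℂ A A]
    [StarModule ℂ A] [CompleteSpace A] :
    (∀ x y : A, x * y = y * x) ↔
      ∀ a x : A, (1 / 2 : ℂ) • (a * star a * x + x * (star a * a)) ∈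
        closure {z : A | ∃ y : A, z = a * y * a} := by
  let _ : NonUnitalCStarAlgebra A := {}
  constructor
  · intro hc a x
    have e : (1 / 2 : ℂ) • (a * star a * x + x * (star a * a)) = star a * a * x := by
      rw [hc x, hc a (star a), ← two_smul ℂ, smul_smul]
      norm_num
    rw [e]
    exact star_mul_self_mul_mem_closure hc a x
  · intro H
    exact mul_comm_of_reduced fun a => eq_zero_of_L_mem_inner_ideal_of_mul_self_eq_zero (H a)
end

section
/- Let M be a von Neumann algebra acting on a complex Hilbert space H. Then M is commutative if and only if for every e ∈ M with e e* e = e (i.e., every partial isometry in M) and every x ∈ M, the element (1/2)(e e* x + x e* e) belongs to the set { e e* y e* e : y ∈ M }. -/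
/-- In a von Neumann algebra `M`, the projection onto the kernel of an operator commuting with
`M.commutant` lies in `M`. -/
theorem VonNeumannAlgebra.starProjection_ker_mem {H : Type*} [NormedAddCommGroup H]
    [InnerProductSpace ℂ H] [CompleteSpace H] (M : VonNeumannAlgebra H) {a : H →L[ℂ] H}
    (ha : a ∈ M) [a.ker.HasOrthogonalProjection] : a.ker.starProjection ∈ M := by
  rw [VonNeumannAlgebra.IsStarProjection.mem_iff isStarProjection_starProjection]
  intro y hy
  rw [Submodule.range_starProjection, Module.End.mem_invtSubmodule]
  intro v hv
  have hc := VonNeumannAlgebra.mem_commutant_iff.1 hy a ha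
  have hv' : a v = 0 := hv
  change a (y v) = 0
  have := congrArg (fun T : H →L[ℂ] H => T v) hc
  simpa [hv'] using this

/-- A von Neumann algebra is closed under the continuous functional calculus of its self-adjoint
elements. -/
theorem VonNeumannAlgebra.cfc_mem {H : Type*} [NormedAddCommGroup H]
    [InnerProductSpace ℂ H] [CompleteSpace H] (M : VonNeumannAlgebra H) {b : H →L[ℂ] H}
    (hb : b ∈ M) (f : ℝ → ℝ) : cfc f b ∈ M := by
  rw [← M.commutant_commutant, VonNeumannAlgebra.mem_commutant_iff]
  intro y hy
  exact (Commute.cfc_real (VonNeumannAlgebra.mem_commutant_iff.1 hy b hb) f).eq.symm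

/-- A von Neumann algebra is closed under multiplication by real scalars. -/
theorem VonNeumannAlgebra.real_smul_mem {H : Type*} [NormedAddCommGroup H]
    [InnerProductSpace ℂ H] [CompleteSpace H] (M : VonNeumannAlgebra H) (r : ℝ) {a : H →L[ℂ] H}
    (ha : a ∈ M) : r • a ∈ M :=
  M.toStarSubalgebra.smul_mem ha (r : ℂ)

/-- If all projections of `M` are central, every self-adjoint `b ∈ M` is within `‖b‖ / 2` of a
self-adjoint central element. -/
theorem VonNeumannAlgebra.exists_central_norm_sub_le {H : Type*} [NormedAddCommGroup H]
    [InnerProductSpace ℂ H] [CompleteSpace H] (M : VonNeumannAlgebra H)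
    (hM : ∀ p ∈ M, IsStarProjection p → ∀ x ∈ M, Commute p x)
    {b : H →L[ℂ] H} (hb : b ∈ M) (hsa : IsSelfAdjoint b) :
    ∃ z ∈ M, IsSelfAdjoint z ∧ (∀ x ∈ M, Commute z x) ∧ ‖b - z‖ ≤ ‖b‖ / 2 := by
  set P := cfc (fun t : ℝ => max t 0) b with hP
  set N := cfc (fun t : ℝ => max (-t) 0) b with hN
  set q := P.ker.starProjection with hq
  have hqs : IsStarProjection q := isStarProjection_starProjection
  have hqM : q ∈ M := M.starProjection_ker_mem (M.cfc_mem hb _)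
  have hPN : P * N = 0 := by
    rw [hP, hN, ← cfc_mul _ _ b, ← cfc_zero ℝ b]
    refine cfc_congr fun t _ => ?_
    rcases le_total t 0 with h | h <;> simp [h]
  have hPq : P * q = 0 := by
    ext v
    exact Submodule.starProjection_apply_mem P.ker v
  have hqP : q * P = 0 := by
    have hPsa : IsSelfAdjoint P := cfc_predicate _ b
    simpa [hPsa.star_eq, hqs.isSelfAdjoint.star_eq] using congrArg star hPq
  have hqN : q * N = N := by
    ext v
    exact Submodule.starProjection_eq_self_iff.2
      (show P (N v) = 0 from congrArg (fun T : H →L[ℂ] H => T v) hPN)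
  have hbPN : P - N = b := by
    rw [hP, hN, ← cfc_sub _ _ b]
    conv_rhs => rw [← cfc_id' ℝ b]
    refine cfc_congr fun t _ => ?_
    rcases le_total t 0 with h | h <;> simp [h]
  have hu : ‖P + N - algebraMap ℝ _ (‖b‖ / 2)‖ ≤ ‖b‖ / 2 := by
    rw [hP, hN, ← cfc_add b _ _, ← cfc_const (‖b‖ / 2) b, ← cfc_sub _ _ b]
    refine norm_cfc_le (by positivity) fun t ht => ?_
    have ht' : ‖t‖ ≤ ‖b‖ := by
      have := spectrum.norm_le_norm_mul_of_mem ht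
      refine this.trans ?_
      exact mul_le_of_le_one_right (norm_nonneg _) ContinuousLinearMap.norm_id_le
    rw [Real.norm_eq_abs] at ht' ⊢
    have := neg_abs_le t
    have := le_abs_self t
    rcases le_total t 0 with h | h <;> rw [abs_le] <;> simp [h] <;> linarith
  have hw : 1 - 2 * q ∈ unitary (H →L[ℂ] H) := by
    have h2 : (1 - 2 * q) * (1 - 2 * q) = 1 := by
      have h4 : (1 - 2 * q) * (1 - 2 * q) = 1 - 4 * q + 4 * (q * q) := by noncomm_ring
      rw [h4, hqs.isIdempotentElem.eq, sub_add_cancel]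
    have hs : star (1 - 2 * q) = 1 - 2 * q := by
      simp [two_mul, hqs.isSelfAdjoint.star_eq]
    rw [Unitary.mem_iff, hs]
    exact ⟨h2, h2⟩
  refine ⟨(‖b‖ / 2) • (1 - 2 * q), ?_, ?_, ?_, ?_⟩
  · exact M.real_smul_mem _ (sub_mem (one_mem M) (two_mul q ▸ add_mem hqM hqM))
  · refine .smul (.all _) ?_
    rw [two_mul]
    exact (IsSelfAdjoint.one _).sub (hqs.isSelfAdjoint.add hqs.isSelfAdjoint)
  · intro x hx
    refine .smul_left ((Commute.one_left x).sub_left ?_) _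
    rw [two_mul]
    exact (hM q hqM hqs x hx).add_left (hM q hqM hqs x hx)
  · have he : b - (‖b‖ / 2) • (1 - 2 * q) =
        (1 - 2 * q) * (P + N - algebraMap ℝ _ (‖b‖ / 2)) := by
      have h5 : (1 - 2 * q) * (P + N) = P + N - 2 * (q * P) - 2 * (q * N) := by noncomm_ring
      rw [mul_sub, h5, hqP, hqN, ← hbPN, Algebra.algebraMap_eq_smul_one, mul_smul_comm, mul_one]
      noncomm_ring
    rw [he, CStarRing.norm_mem_unitary_mul _ hw]
    exact hu

/-- A von Neumann algebra whose projections are all central is commutative. -/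
theorem VonNeumannAlgebra.commute_of_forall_isStarProjection {H : Type*} [NormedAddCommGroup H]
    [InnerProductSpace ℂ H] [CompleteSpace H] (M : VonNeumannAlgebra H)
    (hM : ∀ p ∈ M, IsStarProjection p → ∀ x ∈ M, Commute p x)
    {a x : H →L[ℂ] H} (ha : a ∈ M) (hx : x ∈ M) : Commute a x := by
  have key : ∀ n : ℕ, ∀ b ∈ M, IsSelfAdjoint b →
      ‖b * x - x * b‖ ≤ (2 * ‖b‖ * ‖x‖) * (1 / 2) ^ n := by
    intro n
    induction n with
    | zero =>
      intro b _ _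
      have h1 := norm_sub_le (b * x) (x * b)
      have h2 := norm_mul_le b x
      have h3 := norm_mul_le x b
      linarith
    | succ n ih =>
      intro b hb hsa
      obtain ⟨z, hz, hzs, hzc, hle⟩ := M.exists_central_norm_sub_le hM hb hsa
      have h := ih (b - z) (sub_mem hb hz) (hsa.sub hzs)
      have he : (b - z) * x - x * (b - z) = b * x - x * b := by
        rw [sub_mul, mul_sub, (hzc x hx).eq]; abel
      rw [he] at h
      refine h.trans ?_
      calc 2 * ‖b - z‖ * ‖x‖ * (1 / 2) ^ n ≤ 2 * (‖b‖ / 2) * ‖x‖ * (1 / 2) ^ n := by gcongr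
        _ = _ := by ring
  have hsac : ∀ b ∈ M, IsSelfAdjoint b → Commute b x := by
    intro b hb hsa
    have hlim : Filter.Tendsto (fun n : ℕ => (2 * ‖b‖ * ‖x‖) * (1 / 2 : ℝ) ^ n) Filter.atTop
        (nhds 0) := by
      simpa using (tendsto_pow_atTop_nhds_zero_of_lt_one (r := (1 / 2 : ℝ)) (by norm_num)
        (by norm_num)).const_mul (2 * ‖b‖ * ‖x‖)
    have := ge_of_tendsto' hlim fun n => key n b hb hsa
    exact sub_eq_zero.1 (norm_le_zero_iff.1 this)
  have hre : (realPart a : H →L[ℂ] H) ∈ M := by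
    rw [realPart_apply_coe]
    exact M.real_smul_mem _ (add_mem ha (star_mem ha))
  have him : (imaginaryPart a : H →L[ℂ] H) ∈ M := by
    rw [imaginaryPart_apply_coe]
    exact M.toStarSubalgebra.smul_mem (M.real_smul_mem _ (sub_mem ha (star_mem ha))) _
  rw [← realPart_add_I_smul_imaginaryPart a]
  exact (hsac _ hre (realPart a).2).add_left ((hsac _ him (imaginaryPart a).2).smul_left _)

/-- A von Neumann algebra `M` on a complex Hilbert space `H` is commutative if and only if for
every partial isometry `e ∈ M` (i.e. `e e* e = e`) and every `x ∈ M`, the element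
`(1/2)(e e* x + x e* e)` lies in `e e* M e* e`.
(In JB*-triple terms: `L(e,e)(M) ⊆ M₂(e)` for every tripotent `e ∈ M`.) -/
theorem vonNeumann_commutative_iff_peirce {H : Type*} [NormedAddCommGroup H]
    [InnerProductSpace ℂ H] [CompleteSpace H] (M : VonNeumannAlgebra H) :
    (∀ x ∈ M, ∀ y ∈ M, x * y = y * x) ↔
      ∀ e ∈ M, e * star e * e = e →
        ∀ x ∈ M, ∃ y ∈ M,
          (1 / 2 : ℂ) • (e * star e * x + x * (star e * e)) = e * star e * y * (star e * e) := by
  constructor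
  · intro hc e he hee x hx
    refine ⟨x, hx, ?_⟩
    have hse := star_mem he
    have h1 : star e * e = e * star e := hc _ hse _ he
    have hp : e * star e * (e * star e) = e * star e := by rw [← mul_assoc, hee]
    have h2 : x * (e * star e) = e * star e * x := hc _ hx _ (mul_mem he hse)
    rw [h1, mul_assoc _ x, h2, ← mul_assoc _ _ x, hp, ← two_smul ℂ, smul_smul]
    norm_num
  · intro h x hx y hy
    refine M.commute_of_forall_isStarProjection ?_ hx hy
    intro p hp hps
    have hpp : p * p = p := hps.isIdempotentElem.eq
    have hst : star p = p := hps.isSelfAdjoint.star_eq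
    have key : ∀ w ∈ M, p * w = p * w * p := by
      intro w hw
      obtain ⟨v, -, hv⟩ := h p hp (by rw [hst, hpp, hpp]) w hw
      rw [hst, hpp] at hv
      have hv' := congrArg (fun T => (2 : ℂ) • T * (1 - p)) hv
      simp only [smul_smul, mul_sub, mul_one, add_mul, smul_add, mul_assoc, hpp, smul_mul_assoc]
        at hv'
      norm_num at hv'
      rw [mul_assoc]
      exact sub_eq_zero.1 (by simpa using hv')
    intro w hw
    have h1 := key w hw
    have h2 := congrArg star (key (star w) (star_mem hw))
    simp only [star_mul, star_star, hst] at h2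
    change p * w = w * p
    rw [h1, h2, mul_assoc]
end
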